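/- arXiv:2510.26657 — 3 statements merged into one kernel-verified Lean document; each statement's English description precedes it below -/
import Mathlib

section
/- Let W be a vector space over the complex numbers, let c be a nonzero complex number, and let T be the linear operator on the space of W-valued polynomial functions given by (Tp)(t) = p(t + c). Suppose p(t) = \sum_{k=0}^{K} w_k t^k with w_0, ..., w_K in W, and suppose that (T - \lambda \cdot id)^N p = 0 for some complex number \lambda with \lambda \neq 1 and some positive integer N. Then w_k = 0 for all k; that is, the only possible generalized eigenvectors of the translation operator T are those with eigenvalue 1. -/
open Polynomial in
theorem Polynomial.taylor_sub_smul_injective {R : Type*} [CommRing R] [IsDomain R] (c : R)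
    {lam : R} (hlam : lam ≠ 1) :
    Function.Injective (taylor c - lam • 1 : Module.End R R[X]) := by
  rw [injective_iff_map_eq_zero]
  intro q hq
  have hcoeff : (1 - lam) * q.leadingCoeff = 0 := by
    have := congrArg (fun r : R[X] => r.coeff q.natDegree) hq
    simpa [sub_mul] using this
  rw [← leadingCoeff_eq_zero]
  exact (mul_eq_zero.mp hcoeff).resolve_left (sub_ne_zero.mpr hlam.symm)

open Polynomial in
theorem dual_translation_sub_smul_pow_apply {R W : Type*} [CommRing R] [AddCommGroup W]
    [Module R W] (c lam : R) (T : Module.End R (R → W))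
    (hT : ∀ (p : R → W) (t : R), T p t = p (t + c)) (f : Module.Dual R W)
    {p : R → W} {q : R[X]} (hpq : ∀ t, f (p t) = q.eval t) (N : ℕ) (t : R) :
    f (((T - lam • 1) ^ N) p t) =
      (((taylor c - lam • 1 : Module.End R R[X]) ^ N) q).eval t := by
  induction N generalizing t with
  | zero => simpa using hpq t
  | succ N ih => simp [pow_succ', hT, ih, taylor_eval]

/-- The translation operator on `W`-valued functions of a complex variable admits no
nonzero generalized eigenvectors among polynomial functions, except for eigenvalue `1`:
if `p(t) = ∑_{k=0}^{K} w_k t^k` and `(T - λ·id)^N p = 0` with `λ ≠ 1`, `N > 0`,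
then all coefficients `w_k` vanish. -/
theorem translation_no_generalized_eigenvectors
    {W : Type*} [AddCommGroup W] [Module ℂ W]
    (c : ℂ) (hc : c ≠ 0)
    (T : Module.End ℂ (ℂ → W))
    (hT : ∀ (p : ℂ → W) (t : ℂ), T p t = p (t + c))
    (K : ℕ) (w : ℕ → W)
    (lam : ℂ) (hlam : lam ≠ 1) (N : ℕ) (hN : 0 < N)
    (h : ((T - lam • 1) ^ N) (fun t : ℂ => ∑ k ∈ Finset.range (K + 1), t ^ k • w k) = 0) :
    ∀ k ≤ K, w k = 0 := by
  intro k hk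
  rw [← Module.forall_dual_apply_eq_zero_iff ℂ]
  intro f
  let q : Polynomial ℂ := ∑ k ∈ Finset.range (K + 1), Polynomial.monomial k (f (w k))
  have hpq (t : ℂ) : f (∑ k ∈ Finset.range (K + 1), t ^ k • w k) = q.eval t := by
    simp [q, Polynomial.eval_finsetSum, mul_comm]
  have hSq : ((Polynomial.taylor c - lam • 1 : Module.End ℂ (Polynomial ℂ)) ^ N) q = 0 := by
    refine Polynomial.funext fun t => ?_
    rw [← dual_translation_sub_smul_pow_apply c lam T hT f hpq, h]
    simp
  have hinj : Function.Injective
      ((Polynomial.taylor c - lam • 1 : Module.End ℂ (Polynomial ℂ)) ^ N) := by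
    rw [Module.End.coe_pow]
    exact (Polynomial.taylor_sub_smul_injective c hlam).iterate N
  have hq : q = 0 := hinj (hSq.trans (map_zero _).symm)
  have hqk : q.coeff k = f (w k) := by
    simp [q, Polynomial.coeff_monomial, Nat.lt_succ_of_le hk]
  rw [← hqk, hq, Polynomial.coeff_zero]
end

section
/- Let V and W be vector spaces over the complex numbers, let N be a nilpotent linear endomorphism of V, let M be a nilpotent linear endomorphism of W, and let \varphi : W \to V be a linear map. Then exp(N) \circ \varphi = \varphi \circ exp(M) if and only if N \circ \varphi = \varphi \circ M. -/
/-- The exponential of a nilpotent endomorphism `f` of a complex vector space,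
given as the finite sum `∑_{k < n} f^k / k!` for any `n` with `f ^ n = 0`. -/
noncomputable def nilpExpEnd {V : Type*} [AddCommGroup V] [Module ℂ V]
    (f : Module.End ℂ V) (n : ℕ) : Module.End ℂ V :=
  ∑ k ∈ Finset.range n, (Nat.factorial k : ℂ)⁻¹ • f ^ k

/-- For nilpotent `a`, the quotient `(exp a - 1) / a` makes sense and is a unit. -/
theorem IsNilpotent.exists_isUnit_exp_eq_mul_add_one {A : Type*} [Ring A] [Algebra ℚ A] {a : A}
    (ha : IsNilpotent a) : ∃ u : A, IsUnit u ∧ IsNilpotent.exp a = u * a + 1 := by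
  obtain ⟨k, hk⟩ := ha
  set v : A := ∑ i ∈ Finset.range k, ((i + 1 + 1).factorial : ℚ)⁻¹ • a ^ i with hv
  have hcomm : Commute v a :=
    Commute.sum_left _ _ _ fun i _ => ((Commute.refl a).pow_left i).smul_left _
  refine ⟨v * a + 1, (hcomm.isNilpotent_mul_left ⟨k, hk⟩).isUnit_add_one, ?_⟩
  have hk2 : a ^ (k + 1 + 1) = 0 := pow_eq_zero_of_le (by lia) hk
  rw [IsNilpotent.exp_eq_sum hk2, Finset.sum_range_succ', Finset.sum_range_succ', hv]
  simp [add_mul, Finset.sum_mul, _root_.pow_succ]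

/-- If `a` and `b` are commuting nilpotent endomorphisms, then `exp a` and `exp b` agree on
exactly those vectors on which `a` and `b` agree. -/
theorem IsNilpotent.exp_apply_eq_exp_apply_iff {X : Type*} [AddCommGroup X] [Module ℂ X]
    [Algebra ℚ (Module.End ℂ X)] {a b : Module.End ℂ X}
    (ha : IsNilpotent a) (hb : IsNilpotent b) (hab : Commute a b) (x : X) :
    IsNilpotent.exp a x = IsNilpotent.exp b x ↔ a x = b x := by
  have hd : IsNilpotent (a - b) := hab.isNilpotent_sub ha hb
  have hdb : Commute b (a - b) := hab.symm.sub_right (Commute.refl b)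
  obtain ⟨u, hu, hexp⟩ := hd.exists_isUnit_exp_eq_mul_add_one
  have hmul : IsNilpotent.exp a - IsNilpotent.exp b = IsNilpotent.exp b * u * (a - b) := by
    have h := IsNilpotent.exp_add_of_commute hdb hb hd
    rw [add_sub_cancel, hexp] at h
    rw [h]
    noncomm_ring
  have hinj := ((Module.End.isUnit_iff _).mp
    ((IsNilpotent.isUnit_exp hb).mul hu)).injective
  rw [← sub_eq_zero, ← LinearMap.sub_apply, hmul, Module.End.mul_apply,
    map_eq_zero_iff _ hinj, LinearMap.sub_apply, sub_eq_zero]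

/-- For nilpotent endomorphisms `N` of `V` and `M` of `W` and a linear map `φ : W → V`,
the exponentiated intertwining relation `exp(N) ∘ φ = φ ∘ exp(M)` holds if and only if
the infinitesimal relation `N ∘ φ = φ ∘ M` holds. -/
theorem expNilpotent_comm_iff_comm
    {V W : Type*} [AddCommGroup V] [Module ℂ V] [AddCommGroup W] [Module ℂ W]
    (N : Module.End ℂ V) (M : Module.End ℂ W) (φ : W →ₗ[ℂ] V)
    (m n : ℕ) (hN : N ^ m = 0) (hM : M ^ n = 0) :
    (nilpExpEnd N m : V →ₗ[ℂ] V) ∘ₗ φ = φ ∘ₗ (nilpExpEnd M n : W →ₗ[ℂ] W)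
      ↔ (N : V →ₗ[ℂ] V) ∘ₗ φ = φ ∘ₗ (M : W →ₗ[ℂ] W) := by
  let _ : Algebra ℚ (Module.End ℂ (W →ₗ[ℂ] V)) := Algebra.compHom _ (algebraMap ℚ ℂ)
  have hsmul (q : ℚ) (f : Module.End ℂ (W →ₗ[ℂ] V)) : q • f = (q : ℂ) • f := rfl
  let L : Module.End ℂ (W →ₗ[ℂ] V) := LinearMap.llcomp ℂ W V V N
  let R : Module.End ℂ (W →ₗ[ℂ] V) := LinearMap.lcomp ℂ V M
  have hLpow (k : ℕ) (ψ : W →ₗ[ℂ] V) : (L ^ k) ψ = (N ^ k) ∘ₗ ψ := by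
    induction k with
    | zero => rfl
    | succ k ih => rw [pow_succ', Module.End.mul_apply, ih, pow_succ']; rfl
  have hRpow (k : ℕ) (ψ : W →ₗ[ℂ] V) : (R ^ k) ψ = ψ ∘ₗ (M ^ k) := by
    induction k with
    | zero => rfl
    | succ k ih => rw [pow_succ', Module.End.mul_apply, ih, pow_succ]; rfl
  have hL : L ^ m = 0 := LinearMap.ext fun ψ => by
    rw [hLpow, hN, LinearMap.zero_comp, LinearMap.zero_apply]
  have hR : R ^ n = 0 := LinearMap.ext fun ψ => by
    rw [hRpow, hM, LinearMap.comp_zero, LinearMap.zero_apply]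
  have hexpL : IsNilpotent.exp L φ = nilpExpEnd N m ∘ₗ φ := by
    ext w
    simp [IsNilpotent.exp_eq_sum hL, nilpExpEnd, hsmul, hLpow, LinearMap.sum_apply]
  have hexpR : IsNilpotent.exp R φ = φ ∘ₗ nilpExpEnd M n := by
    ext w
    simp [IsNilpotent.exp_eq_sum hR, nilpExpEnd, hsmul, hRpow, LinearMap.sum_apply]
  rw [← hexpL, ← hexpR]
  exact IsNilpotent.exp_apply_eq_exp_apply_iff ⟨m, hL⟩ ⟨n, hR⟩ rfl φ
end

section
/- Let A be an algebra over the complex numbers (a \mathbb{C}-vector space with a bilinear multiplication, not assumed associative, commutative, or unital), and let g be a linear endomorphism of A satisfying g(uv) = (gu)(gv) for all u, v in A. Let u, v in A and \lambda, \mu complex numbers such that (g - \lambda)^m u = 0 and (g - \mu)^k v = 0 for some positive integers m and k. Then (g - \lambda\mu)^{m+k-1} (uv) = 0; in particular, the product of a generalized eigenvector of g of eigenvalue \lambda with a generalized eigenvector of eigenvalue \mu lies in the generalized eigenspace of g of eigenvalue \lambda\mu. -/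
/-- The twisted Leibniz rule `(g - ab)(uv) = ((g - a)u)(gv) + a u((g - b)v)` for a
multiplicative endomorphism `g`. -/
lemma sub_smul_one_apply_mul {R A : Type*} [CommRing R] [AddCommGroup A] [Module R A]
    (mul : A →ₗ[R] A →ₗ[R] A) (g : Module.End R A)
    (hg : ∀ u v : A, g (mul u v) = mul (g u) (g v)) (a b : R) (u v : A) :
    (g - (a * b) • 1) (mul u v) =
      mul ((g - a • 1) u) (g v) + a • mul u ((g - b • 1) v) := by
  simp [hg, smul_sub, mul_smul]

/-- If `(g - a)^m u = 0` and `(g - b)^k v = 0` for a multiplicative endomorphism `g`, then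
`(g - ab)^n (uv) = 0` as soon as `m + k ≤ n + 1`. -/
lemma sub_smul_one_pow_apply_mul_eq_zero {R A : Type*} [CommRing R] [AddCommGroup A]
    [Module R A] (mul : A →ₗ[R] A →ₗ[R] A) (g : Module.End R A)
    (hg : ∀ u v : A, g (mul u v) = mul (g u) (g v)) (a b : R) {n m k : ℕ}
    (hn : m + k ≤ n + 1) {u v : A}
    (hu : ((g - a • 1) ^ m) u = 0) (hv : ((g - b • 1) ^ k) v = 0) :
    ((g - (a * b) • 1) ^ n) (mul u v) = 0 := by
  induction n generalizing m k u v with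
  | zero =>
    obtain rfl | rfl : m = 0 ∨ k = 0 := by omega
    · obtain rfl : u = 0 := by simpa using hu
      simp
    · obtain rfl : v = 0 := by simpa using hv
      simp
  | succ n ih =>
    rcases m with _ | m
    · obtain rfl : u = 0 := by simpa using hu
      simp
    rcases k with _ | k
    · obtain rfl : v = 0 := by simpa using hv
      simp
    have hgv : ((g - b • 1) ^ (k + 1)) (g v) = 0 := by
      have hcomm : Commute ((g - b • 1) ^ (k + 1)) g :=
        ((Commute.refl g).sub_left ((Commute.one_left g).smul_left b)).pow_left _
      rw [← Module.End.mul_apply, hcomm.eq, Module.End.mul_apply, hv, map_zero]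
    rw [pow_succ, Module.End.mul_apply, sub_smul_one_apply_mul mul g hg, map_add, map_smul,
      ih (m := m) (k := k + 1) (by omega) (by rwa [pow_succ, Module.End.mul_apply] at hu) hgv,
      ih (m := m + 1) (k := k) (by omega) hu (by rwa [pow_succ, Module.End.mul_apply] at hv),
      smul_zero, add_zero]

/-- If `g` is a multiplicative linear endomorphism of a (not necessarily associative,
commutative, or unital) complex algebra `A` with multiplication `mul`, then the product of
a generalized eigenvector `u` of `g` of eigenvalue `λ` (with `(g - λ)^m u = 0`) and a
generalized eigenvector `v` of eigenvalue `μ` (with `(g - μ)^k v = 0`) is a generalized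
eigenvector of eigenvalue `λμ`: indeed `(g - λμ)^{m+k-1} (uv) = 0`. -/
theorem mul_generalized_eigenvectors
    {A : Type*} [AddCommGroup A] [Module ℂ A]
    (mul : A →ₗ[ℂ] A →ₗ[ℂ] A)
    (g : Module.End ℂ A) (hg : ∀ u v : A, g (mul u v) = mul (g u) (g v))
    (u v : A) (lam mu : ℂ) (m k : ℕ) (hm : 0 < m) (hk : 0 < k)
    (hu : ((g - lam • 1) ^ m) u = 0) (hv : ((g - mu • 1) ^ k) v = 0) :
    ((g - (lam * mu) • 1) ^ (m + k - 1)) (mul u v) = 0 := by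
  exact sub_smul_one_pow_apply_mul_eq_zero mul g hg lam mu (m := m) (k := k) (by omega) hu hv
end
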